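/- arXiv:1906.08359 — 4 statements merged into one kernel-verified Lean document; each statement's English description precedes it below -/
import Mathlib

section
/- Let d ≥ 1 and let g : ℝ^d → ℝ be twice continuously differentiable on the open positive orthant (0,∞)^d, strictly positive there, and monotonically increasing there (if x ≤ y coordinatewise then g(x) ≤ g(y)). Define the elasticity of scale ε(x) = (∑_{k=1}^d x_k · ∂g/∂x_k(x)) / g(x). Assume: (i) for every x in the orthant and every k, ∂ε/∂x_k(x) < 0; (ii) there exist points x_a, x_b in the orthant with every coordinate of x_a strictly smaller than the corresponding coordinate of x_b, such that ε(x_a) > 1 and ε(x_b) < 1; (iii) for every direction v ∈ ℝ^d with all coordinates strictly positive, the function φ_v(α) = g(α·v) on (0,∞) has exactly one point α*_v > 0 at which its second derivative vanishes. Then g is S-shaped: for every such direction v, the second derivative of φ_v is strictly positive on (0, α*_v) and strictly negative on (α*_v, ∞). -/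
open Set

/-- A continuous function on a preconnected set without zeros there, negative at one point, is
negative everywhere. -/
lemma IsPreconnected.neg_of_ne_zero {s : Set ℝ} (hs : IsPreconnected s) {f : ℝ → ℝ}
    (hf : ContinuousOn f s) (hne : ∀ x ∈ s, f x ≠ 0) {x y : ℝ} (hx : x ∈ s) (hy : y ∈ s)
    (hfx : f x < 0) : f y < 0 := by
  by_contra! h
  obtain ⟨z, hz, hfz⟩ := hs.intermediate_value hx hy hf ⟨hfx.le, h⟩
  exact hne z hz hfz

/-- A positive function on `(0, ∞)` with antitone derivative satisfies `a * φ' a ≤ φ a`. -/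
lemma mul_deriv_le_of_antitoneOn_deriv {φ : ℝ → ℝ} (hdiff : DifferentiableOn ℝ φ (Ioi 0))
    (hpos : ∀ x, 0 < x → 0 < φ x) (hanti : AntitoneOn (deriv φ) (Ioi 0)) {a : ℝ} (ha : 0 < a) :
    a * deriv φ a ≤ φ a := by
  by_contra! h
  have hφa := hpos a ha
  have hD : 0 < deriv φ a := pos_of_mul_pos_right (hφa.trans h) ha.le
  have ht : 0 < a - φ a / deriv φ a := by rw [sub_pos, div_lt_iff₀ hD]; exact h
  have hta : a - φ a / deriv φ a < a := by linarith [div_pos hφa hD]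
  obtain ⟨c, hc, hslope⟩ := exists_deriv_eq_slope φ hta
    (hdiff.continuousOn.mono fun x hx => ht.trans_le hx.1)
    (hdiff.mono fun x hx => ht.trans hx.1)
  have hle := hanti (mem_Ioi.2 (ht.trans hc.1)) ha hc.2.le
  have hpt := hpos _ ht
  rw [hslope, sub_sub_cancel, div_div_eq_mul_div, le_div_iff₀ hφa] at hle
  nlinarith

/-- A positive `C²` function on `(0, ∞)` whose second derivative has a single zero `s`, whose
elasticity exceeds one somewhere, and which is strictly concave at some point beyond `s`, is
S-shaped. -/
lemma sShaped_of_unique_inflection {φ : ℝ → ℝ} (hφ : ContDiffOn ℝ 2 φ (Ioi 0))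
    (hpos : ∀ x, 0 < x → 0 < φ x) {s : ℝ} (hs : 0 < s) (hzero : deriv (deriv φ) s = 0)
    (huniq : ∀ x, 0 < x → deriv (deriv φ) x = 0 → x = s)
    {a : ℝ} (ha : 0 < a) (hea : φ a < a * deriv φ a)
    {b : ℝ} (hsb : s < b) (hb : deriv (deriv φ) b < 0) :
    (∀ x ∈ Ioo 0 s, 0 < deriv (deriv φ) x) ∧ ∀ x ∈ Ioi s, deriv (deriv φ) x < 0 := by
  have hφ' : ContDiffOn ℝ 1 (deriv φ) (Ioi 0) := hφ.deriv_of_isOpen isOpen_Ioi (by norm_num)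
  have hcont : ContinuousOn (deriv (deriv φ)) (Ioi 0) :=
    hφ'.continuousOn_deriv_of_isOpen isOpen_Ioi le_rfl
  have hright : ∀ x ∈ Ioi s, deriv (deriv φ) x < 0 := fun x hx =>
    isPreconnected_Ioi.neg_of_ne_zero (hcont.mono (Ioi_subset_Ioi hs.le))
      (fun y hy h => (ne_of_gt hy) (huniq y (hs.trans hy) h)) hsb hx hb
  refine ⟨fun x hx => ?_, hright⟩
  have hne : ∀ y ∈ Ioo 0 s, deriv (deriv φ) y ≠ 0 := fun y hy h => hy.2.ne (huniq y hy.1 h)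
  by_contra! hle
  have hleft : ∀ y ∈ Ioo 0 s, deriv (deriv φ) y < 0 := fun y hy =>
    isPreconnected_Ioo.neg_of_ne_zero (hcont.mono Ioo_subset_Ioi_self) hne hx hy
      (hle.lt_of_ne (hne x hx))
  have hanti : AntitoneOn (deriv φ) (Ioi 0) := by
    refine antitoneOn_of_deriv_nonpos (convex_Ioi 0) hφ'.continuousOn ?_ ?_
    · rw [interior_Ioi]
      exact hφ'.differentiableOn one_ne_zero
    · rw [interior_Ioi]
      intro y hy
      rcases lt_trichotomy y s with h | rfl | h
      · exact (hleft y ⟨hy, h⟩).le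
      · exact hzero.le
      · exact (hright y h).le
  exact hea.not_ge
    (mul_deriv_le_of_antitoneOn_deriv (hφ.differentiableOn two_ne_zero) hpos hanti ha)

/-- If the elasticity `x * φ' x / φ x` is below one and has negative derivative at `b`, then
`φ'' b < 0`. -/
lemma deriv_deriv_neg_of_elasticity {φ e : ℝ → ℝ} {b e' : ℝ} (hb : 0 < b) (hφb : 0 < φ b)
    (hφ : DifferentiableAt ℝ φ b) (hφ' : DifferentiableAt ℝ (deriv φ) b)
    (hmono : 0 ≤ deriv φ b) (he : e =ᶠ[nhds b] fun x => x * deriv φ x / φ x)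
    (hderiv : HasDerivAt e e' b) (he' : e' < 0) (heb : e b < 1) :
    deriv (deriv φ) b < 0 := by
  have h := (((hasDerivAt_id b).mul hφ'.hasDerivAt).div hφ.hasDerivAt hφb.ne').congr_of_eventuallyEq
    he
  have heq := hderiv.unique h
  have heb' := heb
  rw [he.eq_of_nhds, div_lt_one hφb] at heb'
  rw [heq, div_lt_iff₀ (by positivity)] at he'
  simp only [id, Pi.mul_apply] at he'
  by_contra! hcon
  have h₁ : 0 ≤ deriv φ b * (φ b - b * deriv φ b) := mul_nonneg hmono (by linarith)
  have h₂ : 0 ≤ b * deriv (deriv φ) b * φ b := by positivity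
  nlinarith

/-- A continuous linear functional in terms of its values on the standard basis. -/
lemma ContinuousLinearMap.apply_eq_sum_single {d : ℕ} (L : (Fin d → ℝ) →L[ℝ] ℝ) (v : Fin d → ℝ) :
    L v = ∑ k, v k * L (Pi.single k 1) := by
  conv_lhs => rw [pi_eq_sum_univ' v]
  simp [map_sum, Pi.single]

/-- A function on the positive orthant with nonpositive partial derivatives is antitone there. -/
lemma antitone_of_partial_nonpos {d : ℕ} {f : (Fin d → ℝ) → ℝ}
    (hf : ∀ x : Fin d → ℝ, (∀ k, 0 < x k) → DifferentiableAt ℝ f x)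
    (hneg : ∀ x : Fin d → ℝ, (∀ k, 0 < x k) → ∀ k, fderiv ℝ f x (Pi.single k 1) ≤ 0)
    {x y : Fin d → ℝ} (hx : ∀ k, 0 < x k) (hxy : ∀ k, x k ≤ y k) : f y ≤ f x := by
  have hpos : ∀ t ∈ Icc (0 : ℝ) 1, ∀ k, 0 < (x + t • (y - x)) k := fun t ht k => by
    have := mul_nonneg ht.1 (sub_nonneg.2 (hxy k))
    have := hx k
    simp only [Pi.add_apply, Pi.smul_apply, Pi.sub_apply, smul_eq_mul]
    linarith
  have hd : ∀ t ∈ Icc (0 : ℝ) 1, HasDerivAt (fun t : ℝ => f (x + t • (y - x)))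
      (fderiv ℝ f (x + t • (y - x)) (y - x)) t := fun t ht => by
    have h := ((hasDerivAt_id t).smul_const (y - x)).const_add x
    rw [one_smul] at h
    exact (hf _ (hpos t ht)).hasFDerivAt.comp_hasDerivAt t h
  have hanti : AntitoneOn (fun t : ℝ => f (x + t • (y - x))) (Icc 0 1) := by
    refine antitoneOn_of_deriv_nonpos (convex_Icc 0 1)
      (fun t ht => (hd t ht).continuousAt.continuousWithinAt)
      (fun t ht => (hd t (interior_subset ht)).differentiableAt.differentiableWithinAt)
      fun t ht => ?_
    have ht' := interior_subset ht
    rw [(hd t ht').deriv, ContinuousLinearMap.apply_eq_sum_single]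
    exact Finset.sum_nonpos fun k _ =>
      mul_nonpos_of_nonneg_of_nonpos (sub_nonneg.2 (hxy k)) (hneg _ (hpos t ht') k)
  have h := hanti (left_mem_Icc.2 zero_le_one) (right_mem_Icc.2 zero_le_one) zero_le_one
  simpa using h

/-- Lemma 1 of the paper (multivariate form): a twice continuously differentiable,
positive, monotone increasing production function on the positive orthant satisfying
the RUP law, with a single inflection point along each ray from the origin, is
S-shaped. -/
theorem rup_law_implies_s_shape
    (d : ℕ) (hd : 1 ≤ d) (g : (Fin d → ℝ) → ℝ)
    (hsmooth : ContDiffOn ℝ 2 g {x : Fin d → ℝ | ∀ k, 0 < x k})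
    (hpos : ∀ x : Fin d → ℝ, (∀ k, 0 < x k) → 0 < g x)
    (hmono : ∀ x y : Fin d → ℝ, (∀ k, 0 < x k) → (∀ k, 0 < y k) →
      (∀ k, x k ≤ y k) → g x ≤ g y)
    (ε : (Fin d → ℝ) → ℝ)
    (hε : ∀ x : Fin d → ℝ, (∀ k, 0 < x k) →
      ε x = (∑ k, x k * fderiv ℝ g x (Pi.single k 1)) / g x)
    (hεdec : ∀ x : Fin d → ℝ, (∀ k, 0 < x k) →
      ∀ k, fderiv ℝ ε x (Pi.single k 1) < 0)
    (xa xb : Fin d → ℝ) (hxa : ∀ k, 0 < xa k) (hab : ∀ k, xa k < xb k)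
    (hεa : 1 < ε xa) (hεb : ε xb < 1)
    (hinfl : ∀ v : Fin d → ℝ, (∀ k, 0 < v k) →
      ∃! αstar : ℝ, 0 < αstar ∧
        deriv (deriv (fun β : ℝ => g (β • v))) αstar = 0) :
    ∀ v : Fin d → ℝ, (∀ k, 0 < v k) →
      ∀ αstar : ℝ, 0 < αstar →
        deriv (deriv (fun β : ℝ => g (β • v))) αstar = 0 →
        (∀ α ∈ Set.Ioo (0 : ℝ) αstar,
          0 < deriv (deriv (fun β : ℝ => g (β • v))) α) ∧
        (∀ α ∈ Set.Ioi αstar,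
          deriv (deriv (fun β : ℝ => g (β • v))) α < 0) := by
  intro v hv s hs hzero
  set φ : ℝ → ℝ := fun β => g (β • v) with hφdef
  have hray : ∀ β : ℝ, 0 < β → ∀ k, 0 < (β • v) k := fun β hβ k => mul_pos hβ (hv k)
  have hopen : IsOpen {x : Fin d → ℝ | ∀ k, 0 < x k} := by
    simp only [ofPred_forall]
    exact isOpen_iInter_of_finite fun k => isOpen_lt continuous_const (continuous_apply k)
  have hline : ∀ β : ℝ, HasDerivAt (fun β : ℝ => β • v) v β := fun β => by
    simpa using (hasDerivAt_id β).smul_const v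
  have hφ : ContDiffOn ℝ 2 φ (Ioi 0) :=
    hsmooth.comp (contDiff_id.smul contDiff_const).contDiffOn fun β hβ => hray β hβ
  have hφ' : ContDiffOn ℝ 1 (deriv φ) (Ioi 0) := hφ.deriv_of_isOpen isOpen_Ioi (by norm_num)
  have hφderiv : ∀ β : ℝ, 0 < β → deriv φ β = fderiv ℝ g (β • v) v := fun β hβ =>
    (((hsmooth.differentiableOn two_ne_zero).differentiableAt
      (hopen.mem_nhds (hray β hβ))).hasFDerivAt.comp_hasDerivAt β (hline β)).deriv
  have hεray : ∀ β : ℝ, 0 < β → ε (β • v) = β * deriv φ β / φ β := fun β hβ => by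
    rw [hε _ (hray β hβ), hφderiv β hβ, ContinuousLinearMap.apply_eq_sum_single, Finset.mul_sum]
    simp only [Pi.smul_apply, smul_eq_mul, mul_assoc, hφdef]
  have hεdiff : ∀ x : Fin d → ℝ, (∀ k, 0 < x k) → DifferentiableAt ℝ ε x := fun x hx => by
    by_contra h
    have := hεdec x hx ⟨0, hd⟩
    simp [fderiv_zero_of_not_differentiableAt h] at this
  have hεanti : ∀ x y : Fin d → ℝ, (∀ k, 0 < x k) → (∀ k, x k ≤ y k) → ε y ≤ ε x :=
    fun x y hx hxy => antitone_of_partial_nonpos hεdiff (fun z hz k => (hεdec z hz k).le) hx hxy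
  have hφpos : ∀ β, 0 < β → 0 < φ β := fun β hβ => hpos _ (hray β hβ)
  have huniq : ∀ β, 0 < β → deriv (deriv φ) β = 0 → β = s := fun β hβ h =>
    (hinfl v hv).unique ⟨hβ, h⟩ ⟨hs, hzero⟩
  obtain ⟨a, ha, hav⟩ : ∃ a : ℝ, 0 < a ∧ ∀ k, (a • v) k ≤ xa k := by
    have h : ∀ᶠ a in nhdsWithin (0 : ℝ) (Ioi 0), ∀ k, a * v k < xa k := by
      refine Filter.eventually_all.2 fun k => nhdsWithin_le_nhds ?_
      exact (continuous_mul_const (v k)).continuousAt.eventually_lt continuousAt_const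
        (by simpa using hxa k)
    obtain ⟨a, hlt, ha⟩ := (h.and self_mem_nhdsWithin).exists
    exact ⟨a, ha, fun k => (hlt k).le⟩
  obtain ⟨b, hsb, hbv⟩ : ∃ b : ℝ, s < b ∧ ∀ k, xb k ≤ (b • v) k := by
    have h : ∀ᶠ b in Filter.atTop, ∀ k, xb k ≤ b * v k := Filter.eventually_all.2 fun k =>
      (Filter.tendsto_id.atTop_mul_const (hv k)).eventually_ge_atTop (xb k)
    exact ((Filter.eventually_gt_atTop s).and h).exists
  have hb : 0 < b := hs.trans hsb
  have hea : φ a < a * deriv φ a := by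
    have := hεa.trans_le (hεanti _ _ (hray a ha) hav)
    rwa [hεray a ha, one_lt_div (hφpos a ha)] at this
  have heb : ε (b • v) < 1 :=
    (hεanti _ _ (fun k => (hxa k).trans (hab k)) hbv).trans_lt hεb
  have hmonoφ : MonotoneOn φ (Ioi 0) := fun x hx y hy hxy =>
    hmono _ _ (hray x hx) (hray y hy) fun k => mul_le_mul_of_nonneg_right hxy (hv k).le
  refine sShaped_of_unique_inflection hφ hφpos hs hzero huniq ha hea hsb ?_
  refine deriv_deriv_neg_of_elasticity (e := fun β => ε (β • v)) hb (hφpos b hb)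
    ((hφ.differentiableOn two_ne_zero).differentiableAt (Ioi_mem_nhds hb))
    ((hφ'.differentiableOn one_ne_zero).differentiableAt (Ioi_mem_nhds hb)) ?_ ?_
    ((hεdiff _ (hray b hb)).hasFDerivAt.comp_hasDerivAt b (hline b)) ?_ heb
  · rw [← derivWithin_of_mem_nhds (Ioi_mem_nhds hb)]
    exact hmonoφ.derivWithin_nonneg
  · filter_upwards [Ioi_mem_nhds hb] with β hβ using hεray β hβ
  · rw [ContinuousLinearMap.apply_eq_sum_single]
    exact Finset.sum_neg (fun k _ => mul_neg_of_pos_of_neg (hv k) (hεdec _ (hray b hb) k))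
      ⟨⟨0, hd⟩, Finset.mem_univ _⟩
end

section
/- Let g : ℝ → ℝ be twice differentiable on (0,∞) with continuous second derivative there, with g(x) > 0 and g'(x) ≥ 0 for all x > 0. Define ε(x) = x·g'(x)/g(x) for x > 0. Assume: (i) ε'(x) < 0 for every x > 0; (ii) there exists x_A > 0 with ε(x_A) > 1; (iii) there exists x_B > x_A with ε(x_B) < 1; and (iv) there is a unique point x* > 0 with g''(x*) = 0. Then g''(x) > 0 for all x ∈ (0, x*) and g''(x) < 0 for all x ∈ (x*, ∞). -/
open Set

/-- A continuous real function without zeros on a preconnected set has constant sign there. -/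
theorem IsPreconnected.forall_pos_or_forall_neg {α : Type*} [TopologicalSpace α] {s : Set α}
    {f : α → ℝ} (hs : IsPreconnected s) (hf : ContinuousOn f s) (h0 : ∀ x ∈ s, f x ≠ 0) :
    (∀ x ∈ s, 0 < f x) ∨ ∀ x ∈ s, f x < 0 := by
  by_contra! h
  obtain ⟨⟨x, hx, hfx⟩, y, hy, hfy⟩ := h
  obtain ⟨z, hz, hfz⟩ := hs.intermediate_value hx hy hf ⟨hfx, hfy⟩
  exact h0 z hz hfz

/-- A positive function on `(0, b)` with antitone derivative lies above `x * g' x`. -/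
theorem mul_deriv_le_of_antitoneOn_deriv_s1 {g : ℝ → ℝ} {b x : ℝ}
    (hd : ∀ y ∈ Ioo 0 b, DifferentiableAt ℝ g y) (hpos : ∀ y ∈ Ioo 0 b, 0 < g y)
    (hanti : AntitoneOn (deriv g) (Ioo 0 b)) (hx : x ∈ Ioo 0 b) :
    x * deriv g x ≤ g x := by
  by_contra! h
  have hgx := hpos x hx
  have hg' : 0 < deriv g x := by
    by_contra! hle
    linarith [mul_nonpos_of_nonneg_of_nonpos hx.1.le hle]
  -- the tangent line at `x` vanishes at a positive point `x - t`
  obtain ⟨t, ht⟩ : ∃ t, t = g x / deriv g x := ⟨_, rfl⟩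
  have ht0 : 0 < t := ht ▸ div_pos hgx hg'
  have htx : t < x := by rw [ht, div_lt_iff₀ hg']; exact h
  have hmem : ∀ y ∈ Icc (x - t) x, y ∈ Ioo 0 b := fun y hy =>
    ⟨by linarith [hy.1], hy.2.trans_lt hx.2⟩
  obtain ⟨c, hc, hceq⟩ := exists_deriv_eq_slope g (sub_lt_self x ht0)
    (fun y hy => (hd y (hmem y hy)).continuousAt.continuousWithinAt)
    (fun y hy => (hd y (hmem y (Ioo_subset_Icc_self hy))).differentiableWithinAt)
  have hle := hanti (hmem c (Ioo_subset_Icc_self hc)) hx hc.2.le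
  rw [hceq, sub_sub_cancel, le_div_iff₀ ht0, ht, mul_div_cancel₀ _ hg'.ne'] at hle
  have := hpos (x - t) (hmem _ ⟨le_rfl, by linarith⟩)
  rw [ht] at this
  linarith

/-- Univariate case of Lemma 1 of the paper: a positive, monotone increasing, twice
continuously differentiable function on `(0,∞)` whose elasticity of scale
`ε x = x * g' x / g x` is strictly decreasing, exceeds 1 at some point and drops
below 1 at a larger point, and whose second derivative has exactly one zero `x*`,
is convex on `(0, x*)` and concave on `(x*, ∞)`. -/
theorem rup_law_implies_s_shape_univariate
    (g : ℝ → ℝ)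
    (hd1 : ∀ x : ℝ, 0 < x → DifferentiableAt ℝ g x)
    (hd2 : ∀ x : ℝ, 0 < x → DifferentiableAt ℝ (deriv g) x)
    (hc2 : ContinuousOn (deriv (deriv g)) (Set.Ioi (0 : ℝ)))
    (hpos : ∀ x : ℝ, 0 < x → 0 < g x)
    (hmono : ∀ x : ℝ, 0 < x → 0 ≤ deriv g x)
    (hεdec : ∀ x : ℝ, 0 < x →
      deriv (fun y => y * deriv g y / g y) x < 0)
    (xA : ℝ) (hxA : 0 < xA) (hεA : 1 < xA * deriv g xA / g xA)
    (xB : ℝ) (hxB : xA < xB) (hεB : xB * deriv g xB / g xB < 1)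
    (xstar : ℝ) (hxstar : 0 < xstar)
    (hzero : deriv (deriv g) xstar = 0)
    (huniq : ∀ y : ℝ, 0 < y → deriv (deriv g) y = 0 → y = xstar) :
    (∀ x ∈ Set.Ioo (0 : ℝ) xstar, 0 < deriv (deriv g) x) ∧
    (∀ x ∈ Set.Ioi xstar, deriv (deriv g) x < 0) := by
  have hεanti : StrictAntiOn (fun y => y * deriv g y / g y) (Ioi 0) := by
    refine strictAntiOn_of_deriv_neg (convex_Ioi 0) (fun x hx => ?_) fun x hx => ?_
    · exact ((continuousAt_id.mul (hd2 x hx).continuousAt).div (hd1 x hx).continuousAt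
        (hpos x hx).ne').continuousWithinAt
    · rw [interior_Ioi] at hx
      exact hεdec x hx
  have hleft : ∀ x ∈ Ioo 0 xstar, 0 < deriv (deriv g) x := by
    refine (isPreconnected_Ioo.forall_pos_or_forall_neg (hc2.mono fun x hx => hx.1)
      fun x hx h => hx.2.ne (huniq x hx.1 h)).resolve_right fun hneg => ?_
    have hanti : AntitoneOn (deriv g) (Ioo 0 xstar) := by
      refine (strictAntiOn_of_deriv_neg (convex_Ioo 0 xstar)
        (fun x hx => (hd2 x hx.1).continuousAt.continuousWithinAt) fun x hx => ?_).antitoneOn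
      rw [interior_Ioo] at hx
      exact hneg x hx
    obtain ⟨x, hx0, hx⟩ := exists_between (lt_min hxA hxstar)
    have hxA' := hx.trans_le (min_le_left _ _)
    have hle := mul_deriv_le_of_antitoneOn_deriv_s1 (fun y hy => hd1 y hy.1)
      (fun y hy => hpos y hy.1) hanti ⟨hx0, hx.trans_le (min_le_right _ _)⟩
    have hε : 1 < x * deriv g x / g x := hεA.trans (hεanti hx0 hxA hxA')
    rw [one_lt_div (hpos x hx0)] at hε
    exact hε.not_ge hle
  refine ⟨hleft, ?_⟩
  refine (isPreconnected_Ioi.forall_pos_or_forall_neg (hc2.mono fun x hx => hxstar.trans hx)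
    fun x hx h => (ne_of_gt hx) (huniq x (hxstar.trans hx) h)).resolve_left fun hright => ?_
  have hnonneg : ∀ x, 0 < x → 0 ≤ deriv (deriv g) x := fun x hx => by
    rcases lt_trichotomy x xstar with h | h | h
    · exact (hleft x ⟨hx, h⟩).le
    · rw [h, hzero]
    · exact (hright x h).le
  have hderiv : ∀ x, 0 < x →
      HasDerivAt (fun y => y * deriv g y - g y) (x * deriv (deriv g) x) x := fun x hx =>
    (((hasDerivAt_id x).mul (hd2 x hx).hasDerivAt).sub (hd1 x hx).hasDerivAt).congr_deriv
      (by simp)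
  have hmonoφ : MonotoneOn (fun y => y * deriv g y - g y) (Ioi 0) := by
    refine monotoneOn_of_deriv_nonneg (convex_Ioi 0)
      (fun x hx => (hderiv x hx).continuousAt.continuousWithinAt) ?_ ?_ <;>
      rw [interior_Ioi]
    · exact fun x hx => (hderiv x hx).differentiableAt.differentiableWithinAt
    · intro x hx
      rw [(hderiv x hx).deriv]
      exact mul_nonneg (le_of_lt hx) (hnonneg x hx)
  have hxB0 := hxA.trans hxB
  rw [one_lt_div (hpos xA hxA)] at hεA
  rw [div_lt_one (hpos xB hxB0)] at hεB
  have hle : xA * deriv g xA - g xA ≤ xB * deriv g xB - g xB := hmonoφ hxA hxB0 hxB.le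
  linarith
end

section
/- Let g : ℝ → ℝ be twice differentiable on (0,∞) with g(x) > 0 and g'(x) ≥ 0 for all x > 0, and define ε(x) = x·g'(x)/g(x) for x > 0. If ε'(x) < 0 for every x > 0 and there exists x_B > 0 with ε(x_B) < 1, then g''(x) < 0 for every x > x_B. -/
/-- Key step in the proof of Lemma 1 of the paper: a positive, monotone increasing,
twice differentiable function on `(0,∞)` whose elasticity of scale
`ε x = x * g' x / g x` is strictly decreasing and falls below 1 at `x_B` is strictly
concave beyond `x_B`. -/
theorem concave_beyond_unit_elasticity
    (g : ℝ → ℝ)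
    (hd1 : ∀ x : ℝ, 0 < x → DifferentiableAt ℝ g x)
    (hd2 : ∀ x : ℝ, 0 < x → DifferentiableAt ℝ (deriv g) x)
    (hpos : ∀ x : ℝ, 0 < x → 0 < g x)
    (hmono : ∀ x : ℝ, 0 < x → 0 ≤ deriv g x)
    (hεdec : ∀ x : ℝ, 0 < x →
      deriv (fun y => y * deriv g y / g y) x < 0)
    (xB : ℝ) (hxB : 0 < xB) (hεB : xB * deriv g xB / g xB < 1) :
    ∀ x : ℝ, xB < x → deriv (deriv g) x < 0 := by
  intro x hx
  have hx0 : 0 < x := hxB.trans hx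
  have hε : ∀ y : ℝ, 0 < y → HasDerivAt (fun y => y * deriv g y / g y)
      (((1 * deriv g y + y * deriv (deriv g) y) * g y - y * deriv g y * deriv g y) / g y ^ 2) y :=
    fun y hy => ((hasDerivAt_id' y).mul (hd2 y hy).hasDerivAt).div
      (hd1 y hy).hasDerivAt (hpos y hy).ne'
  have hanti : StrictAntiOn (fun y => y * deriv g y / g y) (Set.Ioi 0) := by
    refine strictAntiOn_of_deriv_neg (convex_Ioi 0)
      (fun y hy => (hε y hy).continuousAt.continuousWithinAt) fun y hy => ?_
    rw [interior_Ioi] at hy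
    exact hεdec y hy
  have hlt : x * deriv g x < g x :=
    (div_lt_one (hpos x hx0)).1 ((hanti hxB hx0 hx).trans hεB)
  have hnum : (1 * deriv g x + x * deriv (deriv g) x) * g x - x * deriv g x * deriv g x < 0 := by
    have h := hεdec x hx0
    rw [(hε x hx0).deriv] at h
    exact neg_of_div_neg_left h (sq_nonneg _)
  have hprod : deriv g x * (x * deriv g x - g x) ≤ 0 :=
    mul_nonpos_of_nonneg_of_nonpos (hmono x hx0) (sub_nonpos.2 hlt.le)
  have hneg : x * g x * deriv (deriv g) x < 0 := by linarith
  exact neg_of_mul_neg_right hneg (mul_pos hx0 (hpos x hx0)).le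
end

section
/- Let F : ℝ → ℝ be twice differentiable and let H : ℝ^d → ℝ be positively homogeneous of degree 1 (H(αx) = αH(x) for all α > 0 and all x). Set g = F ∘ H. Suppose there is a direction v₀ with H(v₀) > 0 and a point α₀ > 0 such that the function φ₀(α) = g(α·v₀) satisfies φ₀''(α) > 0 for all α ∈ (0, α₀) and φ₀''(α) < 0 for all α > α₀. Then for every direction v with H(v) > 0, setting α_v = α₀·H(v₀)/H(v), the function φ_v(α) = g(α·v) satisfies φ_v''(α) > 0 for all α ∈ (0, α_v) and φ_v''(α) < 0 for all α > α_v; moreover H(α_v·v) = H(α₀·v₀), i.e., the inflection points of all rays lie on the same isoquant of H. -/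
open Filter Topology in
/-- Along a ray, the second derivative of `F ∘ H`, for `H` positively homogeneous of degree `1`,
is a rescaling of the second derivative of `F`. -/
lemma deriv_deriv_comp_ray {E : Type*} [SMul ℝ E] (F : ℝ → ℝ) {H : E → ℝ}
    (hH : ∀ (a : ℝ) (x : E), 0 < a → H (a • x) = a * H x) (v : E) {α : ℝ} (hα : 0 < α) :
    deriv (deriv (fun β : ℝ => F (H (β • v)))) α = H v ^ 2 * deriv (deriv F) (H v * α) := by
  have hray : (fun β : ℝ => F (H (β • v))) =ᶠ[𝓝 α] fun β => F (H v * β) := by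
    filter_upwards [lt_mem_nhds hα] with β hβ
    rw [hH β v hβ, mul_comm]
  have hderiv : deriv (fun β : ℝ => F (H v * β)) = fun β => H v * deriv F (H v * β) :=
    funext fun β => deriv_comp_mul_left (H v) F β
  rw [hray.deriv.deriv_eq, hderiv, deriv_const_mul_field, deriv_comp_mul_left, smul_eq_mul]
  ring

/-- Theorem 1 of the paper: for a homothetic production function `g = F ∘ H` (with
`H` positively homogeneous of degree 1), if the S-shape property holds along a single
ray from the origin, then it holds along every ray, and the inflection points of all
rays lie on the same isoquant of `H`. -/
theorem homothetic_s_shape_all_rays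
    {d : ℕ} (F : ℝ → ℝ) (H : (Fin d → ℝ) → ℝ)
    (hF1 : Differentiable ℝ F) (hF2 : Differentiable ℝ (deriv F))
    (hH : ∀ (a : ℝ) (x : Fin d → ℝ), 0 < a → H (a • x) = a * H x)
    (v₀ : Fin d → ℝ) (hv₀ : 0 < H v₀) (α₀ : ℝ) (hα₀ : 0 < α₀)
    (hconv₀ : ∀ α ∈ Set.Ioo (0 : ℝ) α₀,
      0 < deriv (deriv (fun β : ℝ => F (H (β • v₀)))) α)
    (hconc₀ : ∀ α : ℝ, α₀ < α →
      deriv (deriv (fun β : ℝ => F (H (β • v₀)))) α < 0) :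
    ∀ v : Fin d → ℝ, 0 < H v →
      (∀ α ∈ Set.Ioo (0 : ℝ) (α₀ * H v₀ / H v),
        0 < deriv (deriv (fun β : ℝ => F (H (β • v)))) α) ∧
      (∀ α : ℝ, α₀ * H v₀ / H v < α →
        deriv (deriv (fun β : ℝ => F (H (β • v)))) α < 0) ∧
      H ((α₀ * H v₀ / H v) • v) = H (α₀ • v₀) := by
  intro v hv
  have hscale : ∀ α : ℝ, 0 < α →
      deriv (deriv (fun β : ℝ => F (H (β • v)))) α =
        (H v / H v₀) ^ 2 *
          deriv (deriv (fun β : ℝ => F (H (β • v₀)))) (α * H v / H v₀) := by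
    intro α hα
    rw [deriv_deriv_comp_ray F hH v hα, deriv_deriv_comp_ray F hH v₀ (by positivity),
      mul_div_cancel₀ _ hv₀.ne', mul_comm α]
    field_simp
  have hfactor : 0 < (H v / H v₀) ^ 2 := by positivity
  have hinfl : 0 < α₀ * H v₀ / H v := by positivity
  refine ⟨fun α hα => ?_, fun α hα => ?_, ?_⟩
  · have hpos : 0 < α := hα.1
    rw [hscale α hpos]
    refine mul_pos hfactor (hconv₀ _ ⟨by positivity, ?_⟩)
    rw [div_lt_iff₀ hv₀]
    exact (lt_div_iff₀ hv).1 hα.2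
  · rw [hscale α (hinfl.trans hα)]
    refine mul_neg_of_pos_of_neg hfactor (hconc₀ _ ?_)
    rw [lt_div_iff₀ hv₀]
    exact (div_lt_iff₀ hv).1 hα
  · rw [hH _ _ hinfl, hH _ _ hα₀, div_mul_cancel₀ _ hv.ne']
end
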